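/- Asymptotic rates for deterministic Adam: under the stated Adam conditions, there exist positive constants c₁, c₂, c₃, c₄, c₅, c₆ and a time T such that for all t ≥ T: c₁/t ≤ L(w(t)) ≤ c₂/t, c₃·ln t ≤ ‖w(t)‖ ≤ c₄·ln t, and c₅/t ≤ ‖w(t+1) − w(t)‖ ≤ c₆/t. -/

import Mathlib

open Filter Topology RealInnerProductSpace MeasureTheory

set_option linter.unusedVariables false

theorem le_of_sublevel_fencing {φ φ' : ℝ → ℝ} {M K : ℝ} (hK : 0 ≤ K)
    (hφ : ∀ s, HasDerivAt φ (φ' s) s)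
    (hφ' : ∀ s, 0 ≤ s → φ s ≤ M → φ' s ≤ φ' 0 + s * K)
    (h0 : φ 0 < M) (h1 : φ 0 + φ' 0 + K / 2 < M) :
    φ 1 ≤ φ 0 + φ' 0 + K / 2 := by
  have key : ∀ δ, 0 < δ → φ 0 + φ' 0 + K / 2 + δ ≤ M → φ 1 ≤ φ 0 + φ' 0 + K / 2 + δ := by
    intro δ hδ hδM
    have hB : ∀ s : ℝ, HasDerivAt (fun s : ℝ => φ 0 + s * (φ' 0 + δ) + s ^ 2 * (K / 2))
        (φ' 0 + δ + s * K) s := by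
      intro s
      have h := (((hasDerivAt_id s).mul_const (φ' 0 + δ)).const_add (φ 0)).add
        (((hasDerivAt_id s).pow 2).mul_const (K / 2))
      refine h.congr_deriv ?_
      norm_num [id]; ring
    have h := image_le_of_deriv_right_lt_deriv_boundary' (f := φ) (f' := φ') (a := 0) (b := 1)
      (B := fun s : ℝ => φ 0 + s * (φ' 0 + δ) + s ^ 2 * (K / 2))
      (B' := fun s => φ' 0 + δ + s * K)
      (fun s _ => (hφ s).continuousAt.continuousWithinAt)
      (fun s _ => (hφ s).hasDerivWithinAt) (by simp)
      (fun s _ => (hB s).continuousAt.continuousWithinAt)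
      (fun s _ => (hB s).hasDerivWithinAt)
      (by
        rintro s ⟨hs0, hs1⟩ hs
        have hsM : φ s ≤ M := by
          rw [hs]
          have h2 : s ^ 2 * (K / 2) ≤ s * (K / 2) := by
            apply mul_le_mul_of_nonneg_right _ (by linarith)
            nlinarith
          nlinarith
        have := hφ' s hs0 hsM
        linarith)
    have := h (x := 1) (by simp)
    linarith
  apply le_of_forall_pos_le_add
  intro δ hδ
  have hpos : 0 < min δ (M - (φ 0 + φ' 0 + K / 2)) := lt_min hδ (by linarith)
  have := key _ hpos (by linarith [min_le_right δ (M - (φ 0 + φ' 0 + K / 2))])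
  linarith [min_le_left δ (M - (φ 0 + φ' 0 + K / 2))]

theorem descent_of_lipschitz_on_sublevel {E : Type*} [NormedAddCommGroup E]
    [InnerProductSpace ℝ E] {f : E → ℝ} {g : E → E} {H M Y : ℝ} (hH : 0 ≤ H)
    (hf : ∀ u v s, HasDerivAt (fun s : ℝ => f (u + s • v)) ⟪g (u + s • v), v⟫ s)
    (hg : ∀ u v, f u ≤ M → f v ≤ M → ‖g u - g v‖ ≤ H * ‖u - v‖)
    {u v : E} (hu : f u < M) (hY : ⟪g u, v⟫ + H / 2 * ‖v‖ ^ 2 ≤ Y) (hM : f u + Y < M) :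
    f (u + v) ≤ f u + Y := by
  have h := le_of_sublevel_fencing (φ := fun s : ℝ => f (u + s • v))
    (φ' := fun s : ℝ => ⟪g (u + s • v), v⟫) (M := M) (K := H * ‖v‖ ^ 2) (by positivity)
    (hf u v) (by
      intro s hs hsM
      have h1 := hg (u + s • v) u hsM hu.le
      have h2 : ⟪g (u + s • v) - g u, v⟫ ≤ H * (s * ‖v‖) * ‖v‖ := by
        refine (real_inner_le_norm _ _).trans (mul_le_mul_of_nonneg_right ?_ (norm_nonneg _))
        simpa [norm_smul, abs_of_nonneg hs] using h1
      rw [inner_sub_left] at h2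
      simp only [zero_smul, add_zero]
      nlinarith)
    (by simpa using hu) (by simp only [zero_smul, add_zero]; linarith)
  simp only [zero_smul, add_zero, one_smul] at h
  linarith

theorem le_div_of_two_step_quadratic_decrease {U : ℕ → ℝ} {κ : ℝ} (hκ : 0 < κ)
    (hpos : ∀ t, 1 ≤ t → 0 < U t)
    (hU : ∀ t, 1 ≤ t → U (t + 2) ≤ U t - κ * U t ^ 2) :
    ∃ C, 0 < C ∧ ∀ t : ℕ, 4 ≤ t → U t ≤ C / t := by
  have key : ∀ t : ℕ, 1 ≤ t → κ / 2 * ((t : ℝ) - 2) ≤ 1 / U t ∧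
      κ / 2 * (((t + 1 : ℕ) : ℝ) - 2) ≤ 1 / U (t + 1) := by
    intro t ht
    induction t, ht using Nat.le_induction with
    | base =>
      have h1 := hpos 1 le_rfl
      have h2 := hpos 2 (by norm_num)
      constructor
      · have : 0 < 1 / U 1 := by positivity
        push_cast; linarith
      · have : 0 < 1 / U (1 + 1) := by positivity
        push_cast; linarith
    | succ t ht ih =>
      refine ⟨ih.2, ?_⟩
      have h1 := hpos t ht
      have h2 := hpos (t + 2) (by omega)
      have h3 := hU t ht
      have h4 : 1 / U t + κ ≤ 1 / U (t + 2) := by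
        rw [le_div_iff₀ h2]
        have h5 : (1 / U t + κ) * U (t + 2) ≤ (1 / U t + κ) * (U t - κ * U t ^ 2) :=
          mul_le_mul_of_nonneg_left h3 (by positivity)
        have h6 : (1 / U t + κ) * (U t - κ * U t ^ 2) = 1 - κ ^ 2 * U t ^ 2 := by
          field_simp; ring
        nlinarith [sq_nonneg (κ * U t)]
      have := ih.1
      push_cast
      have h7 : t + 1 + 1 = t + 2 := rfl
      rw [h7]
      linarith
  refine ⟨4 / κ, by positivity, fun t ht => ?_⟩
  have h1 := hpos t (by omega)
  have h2 := (key t (by omega)).1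
  have ht' : (4 : ℝ) ≤ t := by exact_mod_cast ht
  rw [le_div_iff₀ h1] at h2
  rw [div_div, le_div_iff₀ (by positivity)]
  nlinarith [mul_pos hκ h1]

theorem div_le_of_exp_decrease {a : ℕ → ℝ} {K M : ℝ} {T : ℕ} (hK : 0 ≤ K)
    (hpos : ∀ t, T ≤ t → 0 < a t) (hM : ∀ t, T ≤ t → a t ≤ M)
    (ha : ∀ t, T ≤ t → a t * Real.exp (-(K * a t)) ≤ a (t + 1)) :
    ∃ c, 0 < c ∧ ∀ t : ℕ, T ≤ t → 1 ≤ t → c / t ≤ a t := by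
  have hM0 : 0 ≤ M := (hpos T le_rfl).le.trans (hM T le_rfl)
  set D := K * Real.exp (K * M) with hD
  have hD0 : 0 ≤ D := by positivity
  have step : ∀ t, T ≤ t → 1 / a (t + 1) ≤ 1 / a t + D := by
    intro t ht
    have h1 := hpos t ht
    have h2 := hpos (t + 1) (by omega)
    have h3 : 1 / a (t + 1) ≤ 1 / a t * Real.exp (K * a t) := by
      have := one_div_le_one_div_of_le (by positivity) (ha t ht)
      refine this.trans (le_of_eq ?_)
      rw [Real.exp_neg]; field_simp
    have h4 : Real.exp (K * a t) ≤ 1 + K * a t * Real.exp (K * a t) := by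
      have h5 := Real.add_one_le_exp (-(K * a t))
      have h6 : Real.exp (-(K * a t)) * Real.exp (K * a t) = 1 := by
        rw [← Real.exp_add]; simp
      nlinarith [Real.exp_pos (K * a t)]
    have h5 : Real.exp (K * a t) ≤ Real.exp (K * M) :=
      Real.exp_le_exp.2 (mul_le_mul_of_nonneg_left (hM t ht) hK)
    have h6 : 1 / a t * Real.exp (K * a t) ≤ 1 / a t * (1 + K * a t * Real.exp (K * M)) := by
      apply mul_le_mul_of_nonneg_left _ (by positivity)
      refine h4.trans ?_
      gcongr
    have h7 : 1 / a t * (1 + K * a t * Real.exp (K * M)) = 1 / a t + D := by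
      rw [hD]; field_simp
    linarith
  have lin : ∀ t, T ≤ t → 1 / a t ≤ 1 / a T + D * t := by
    intro t ht
    induction t, ht using Nat.le_induction with
    | base => have : 0 ≤ D * (T : ℝ) := by positivity
              linarith
    | succ t ht ih => have := step t ht; push_cast; linarith
  have hT := hpos T le_rfl
  refine ⟨1 / (1 / a T + D), by positivity, fun t ht ht1 => ?_⟩
  have ht1' : (1 : ℝ) ≤ t := by exact_mod_cast ht1
  have h1 := hpos t ht
  have h2 := lin t ht
  rw [div_div, div_le_iff₀ (by positivity)]
  have h3 : 1 / a t ≤ (1 / a T + D) * t := by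
    have : 0 < 1 / a T := by positivity
    nlinarith
  rw [div_le_iff₀ h1] at h3
  linarith

theorem exists_le_of_loss_le {ℓ ℓ' : ℝ → ℝ} (hdiff : ∀ s, HasDerivAt ℓ (ℓ' s) s)
    (hℓ'neg : ∀ s, ℓ' s < 0) (hbot : Filter.limsup ℓ' atBot < 0) (M : ℝ) :
    ∃ s₀, ∀ s, ℓ s ≤ M → s₀ ≤ s := by
  have hanti : StrictAnti ℓ := strictAnti_of_hasDerivAt_neg hdiff hℓ'neg
  obtain ⟨a, ha, ha0⟩ : ∃ a, (∀ᶠ s in atBot, ℓ' s ≤ a) ∧ a < 0 := by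
    rw [Filter.limsup_eq] at hbot
    exact exists_lt_of_csInf_lt ⟨0, Eventually.of_forall fun s => (hℓ'neg s).le⟩ hbot
  obtain ⟨b, hb⟩ := eventually_atBot.1 ha
  have hline : ∀ s, s ≤ b → ℓ b + a * (s - b) ≤ ℓ s := by
    intro s hs
    have hmono : AntitoneOn (fun s => ℓ s - a * s) (Set.Iic b) := by
      apply antitoneOn_of_deriv_nonpos (convex_Iic b)
      · exact fun s _ => ((hdiff s).sub ((hasDerivAt_id s).const_mul a)).continuousAt.continuousWithinAt
      · exact fun s _ =>
          ((hdiff s).sub ((hasDerivAt_id s).const_mul a)).differentiableAt.differentiableWithinAt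
      · intro s hs
        rw [interior_Iic] at hs
        have h : HasDerivAt (fun s => ℓ s - a * s) (ℓ' s - a * 1) s :=
          (hdiff s).sub ((hasDerivAt_id s).const_mul a)
        rw [h.deriv]
        linarith [hb s hs.le]
    have := hmono (a := s) (b := b) hs (Set.mem_Iic.2 le_rfl) hs
    simp only at this
    linarith
  refine ⟨min b (b + (M + 1 - ℓ b) / a), fun s hs => ?_⟩
  by_contra! hlt
  have h1 : s < b := hlt.trans_le (min_le_left _ _)
  have h2 : s < b + (M + 1 - ℓ b) / a := hlt.trans_le (min_le_right _ _)
  have h3 := hline s h1.le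
  have h4 : s - b < (M + 1 - ℓ b) / a := by linarith
  rw [lt_div_iff_of_neg ha0] at h4
  linarith

theorem exp_tail_bounds_on_Ici {ℓ' : ℝ → ℝ} {μp μm xp xm : ℝ} (hμp : 0 < μp) (hμm : 0 < μm)
    (hℓ'neg : ∀ s, ℓ' s < 0)
    (htailp : ∀ s : ℝ, xp < s → -ℓ' s ≤ (1 + Real.exp (-μp * s)) * Real.exp (-s))
    (htailm : ∀ s : ℝ, xm < s → (1 - Real.exp (-μm * s)) * Real.exp (-s) ≤ -ℓ' s)
    (hcont : Continuous ℓ') (s₀ : ℝ) :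
    ∃ p q : ℝ, 0 < p ∧ 0 < q ∧ ∀ s, s₀ ≤ s →
      p * Real.exp (-s) ≤ -ℓ' s ∧ -ℓ' s ≤ q * Real.exp (-s) := by
  set S := max s₀ (max (|xp| + 1) (max (|xm| + 1) (1 / μm))) with hS
  have hS1 : s₀ ≤ S := le_max_left _ _
  have hS2 : |xp| + 1 ≤ S := (le_max_left _ _).trans (le_max_right _ _)
  have hS3 : |xm| + 1 ≤ S :=
    (le_max_left _ _).trans ((le_max_right _ _).trans (le_max_right _ _))
  have hS4 : 1 / μm ≤ S :=
    (le_max_right _ _).trans ((le_max_right _ _).trans (le_max_right _ _))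
  have hFc : ContinuousOn (fun s => -ℓ' s * Real.exp s) (Set.Icc s₀ S) := by fun_prop
  obtain ⟨u, -, hu⟩ := isCompact_Icc.exists_isMinOn (Set.nonempty_Icc.2 hS1) hFc
  obtain ⟨v, -, hv⟩ := isCompact_Icc.exists_isMaxOn (Set.nonempty_Icc.2 hS1) hFc
  have hpos : ∀ s, 0 < -ℓ' s * Real.exp s := fun s =>
    mul_pos (by linarith [hℓ'neg s]) (Real.exp_pos s)
  have he : Real.exp (-1) < 1 := by
    rw [← Real.exp_zero]; exact Real.exp_lt_exp.2 (by norm_num)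
  have hall : ∀ s, s₀ ≤ s →
      min (-ℓ' u * Real.exp u) (1 - Real.exp (-1)) ≤ -ℓ' s * Real.exp s ∧
      -ℓ' s * Real.exp s ≤ max (-ℓ' v * Real.exp v) 2 := by
    intro s hs
    rcases le_total s S with h | h
    · exact ⟨(min_le_left _ _).trans (isMinOn_iff.1 hu s ⟨hs, h⟩),
        (isMaxOn_iff.1 hv s ⟨hs, h⟩).trans (le_max_left _ _)⟩
    · have hs0 : 0 < s := by linarith [abs_nonneg xp]
      have h1 := htailp s (by linarith [le_abs_self xp])
      have h2 := htailm s (by linarith [le_abs_self xm])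
      have h3 : Real.exp (-μp * s) ≤ 1 := Real.exp_le_one_iff.2 (by nlinarith)
      have h4 : Real.exp (-μm * s) ≤ Real.exp (-1) := by
        apply Real.exp_le_exp.2
        have : 1 / μm ≤ s := hS4.trans h
        rw [div_le_iff₀ hμm] at this
        linarith
      have h5 : Real.exp (-s) * Real.exp s = 1 := by rw [← Real.exp_add]; simp
      have h6 := mul_le_mul_of_nonneg_right h1 (Real.exp_pos s).le
      have h7 := mul_le_mul_of_nonneg_right h2 (Real.exp_pos s).le
      rw [mul_assoc, h5, mul_one] at h6 h7
      exact ⟨(min_le_right _ _).trans (by linarith), le_trans (by linarith) (le_max_right _ _)⟩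
  refine ⟨min (-ℓ' u * Real.exp u) (1 - Real.exp (-1)), max (-ℓ' v * Real.exp v) 2,
    lt_min (hpos u) (by linarith), lt_max_of_lt_right (by norm_num), fun s hs => ?_⟩
  obtain ⟨h1, h2⟩ := hall s hs
  have h5 : Real.exp s * Real.exp (-s) = 1 := by rw [← Real.exp_add]; simp
  have h6 := mul_le_mul_of_nonneg_right h1 (Real.exp_pos (-s)).le
  have h7 := mul_le_mul_of_nonneg_right h2 (Real.exp_pos (-s)).le
  rw [mul_assoc, h5, mul_one] at h6 h7
  exact ⟨h6, h7⟩

theorem nonpos_of_deriv_nonneg_of_tendsto_zero {f f' : ℝ → ℝ} {s₀ : ℝ}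
    (hf : ∀ s, HasDerivAt f (f' s) s) (hf' : ∀ s, s₀ ≤ s → 0 ≤ f' s)
    (hlim : Tendsto f atTop (𝓝 0)) {s : ℝ} (hs : s₀ ≤ s) : f s ≤ 0 := by
  have hmono : MonotoneOn f (Set.Ici s₀) := by
    apply monotoneOn_of_deriv_nonneg (convex_Ici s₀)
    · exact fun s _ => (hf s).continuousAt.continuousWithinAt
    · exact fun s _ => (hf s).differentiableAt.differentiableWithinAt
    · intro s hs
      rw [interior_Ici] at hs
      rw [(hf s).deriv]
      exact hf' s hs.le
  refine ge_of_tendsto hlim ?_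
  filter_upwards [eventually_ge_atTop s] with r hr
  exact hmono hs (hs.trans hr) hr

theorem loss_bounds_of_deriv_bounds {ℓ ℓ' : ℝ → ℝ} {p q s₀ : ℝ}
    (hdiff : ∀ s, HasDerivAt ℓ (ℓ' s) s) (hℓtop : Tendsto ℓ atTop (𝓝 0))
    (hb : ∀ s, s₀ ≤ s → p * Real.exp (-s) ≤ -ℓ' s ∧ -ℓ' s ≤ q * Real.exp (-s))
    {s : ℝ} (hs : s₀ ≤ s) : p * Real.exp (-s) ≤ ℓ s ∧ ℓ s ≤ q * Real.exp (-s) := by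
  have hexp : ∀ k s : ℝ, HasDerivAt (fun s => k * Real.exp (-s)) (-(k * Real.exp (-s))) s := by
    intro k s
    exact ((hasDerivAt_neg s).exp.const_mul k).congr_deriv (by ring)
  have hlim : ∀ k : ℝ, Tendsto (fun s => k * Real.exp (-s)) atTop (𝓝 0) := by
    intro k
    simpa using (Real.tendsto_exp_neg_atTop_nhds_zero).const_mul k
  constructor
  · have := nonpos_of_deriv_nonneg_of_tendsto_zero (s₀ := s₀)
      (fun s => (hexp p s).sub (hdiff s)) (fun s hs => by linarith [(hb s hs).1])
      (by simpa [Pi.sub_def] using (hlim p).sub hℓtop) hs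
    simp only [Pi.sub_apply] at this
    linarith
  · have := nonpos_of_deriv_nonneg_of_tendsto_zero (s₀ := s₀)
      (fun s => (hdiff s).sub (hexp q s)) (fun s hs => by linarith [(hb s hs).2])
      (by simpa [Pi.sub_def] using hℓtop.sub (hlim q)) hs
    simp only [Pi.sub_apply] at this
    linarith

theorem mul_exp_neg_le_of_neg_deriv_le {ℓ ℓ' : ℝ → ℝ} {K s₀ : ℝ} (hK : 0 ≤ K)
    (hdiff : ∀ s, HasDerivAt ℓ (ℓ' s) s) (hℓpos : ∀ s, 0 < ℓ s) (hℓ'neg : ∀ s, ℓ' s < 0)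
    (hb : ∀ s, s₀ ≤ s → -ℓ' s ≤ K * ℓ s) {a b : ℝ} (ha : s₀ ≤ a) :
    ℓ a * Real.exp (-(K * |b - a|)) ≤ ℓ b := by
  rcases le_total a b with h | h
  · have hd : ∀ s, HasDerivAt (fun s => ℓ s * Real.exp (K * s))
        (ℓ' s * Real.exp (K * s) + ℓ s * (Real.exp (K * s) * (K * 1))) s := fun s =>
      (hdiff s).mul ((hasDerivAt_id s).const_mul K).exp
    have hmono : MonotoneOn (fun s => ℓ s * Real.exp (K * s)) (Set.Ici s₀) := by
      apply monotoneOn_of_deriv_nonneg (convex_Ici s₀)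
      · exact fun s _ => (hd s).continuousAt.continuousWithinAt
      · exact fun s _ => (hd s).differentiableAt.differentiableWithinAt
      · intro s hs
        rw [interior_Ici] at hs
        rw [(hd s).deriv]
        have := hb s hs.le
        nlinarith [Real.exp_pos (K * s)]
    have h1 := hmono ha (ha.trans h) h
    simp only at h1
    rw [abs_of_nonneg (by linarith)]
    have h2 : Real.exp (-(K * (b - a))) = Real.exp (K * a) * Real.exp (-(K * b)) := by
      rw [← Real.exp_add]; ring_nf
    have h3 : Real.exp (K * b) * Real.exp (-(K * b)) = 1 := by rw [← Real.exp_add]; simp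
    have h4 := mul_le_mul_of_nonneg_right h1 (Real.exp_pos (-(K * b))).le
    rw [mul_assoc (ℓ b), h3, mul_one] at h4
    rw [h2, ← mul_assoc]
    exact h4
  · have hanti : StrictAnti ℓ := strictAnti_of_hasDerivAt_neg hdiff hℓ'neg
    have h1 : Real.exp (-(K * |b - a|)) ≤ 1 := Real.exp_le_one_iff.2 (by
      have := mul_nonneg hK (abs_nonneg (b - a)); linarith)
    nlinarith [hanti.antitone h, hℓpos a]

theorem continuous_of_locally_lipschitz_above {f : ℝ → ℝ}
    (hloc : ∀ s : ℝ, ∃ H : ℝ, 0 < H ∧ ∀ a b : ℝ, s ≤ a → s ≤ b → |f a - f b| ≤ H * |a - b|) :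
    Continuous f := by
  rw [continuous_iff_continuousAt]
  intro s
  obtain ⟨H, -, hH⟩ := hloc (s - 1)
  have hlip : LipschitzOnWith H.toNNReal f (Set.Ici (s - 1)) := by
    apply LipschitzOnWith.of_dist_le_mul
    intro a ha b hb
    rw [Real.dist_eq, Real.dist_eq]
    exact (hH a b ha hb).trans
      (mul_le_mul_of_nonneg_right (Real.le_coe_toNNReal H) (abs_nonneg _))
  exact hlip.continuousOn.continuousAt (Ici_mem_nhds (by linarith))

theorem sum_momentum_mul_le {d : ℕ} {P P' D D' m m' g : Fin d → ℝ} {β η a a' k : ℝ}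
    (hβ : β < 1) (hη : 0 < η) (ha : 0 ≤ a) (hk : 0 < k) (hP : ∀ j, 0 ≤ P j)
    (hPk : ∀ j, β ^ 2 * P j ≤ k ^ 2 * P' j)
    (hm : ∀ j, m j = -((1 - β) * a / η) * P j * D j)
    (hm' : ∀ j, m' j = -((1 - β) * a' / η) * P' j * D' j)
    (hg : ∀ j, m' j = β * m j + (1 - β) * g j) :
    ∑ j, g j * D' j ≤ -(a' / η) * ∑ j, P' j * D' j ^ 2 +
      k * a / (2 * η) * (∑ j, P j * D j ^ 2 + ∑ j, P' j * D' j ^ 2) := by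
  rw [← Finset.sum_add_distrib, Finset.mul_sum, Finset.mul_sum, ← Finset.sum_add_distrib]
  refine Finset.sum_le_sum fun j _ => ?_
  have hβ' : 1 - β ≠ 0 := by linarith
  have hgj : g j = -(a' / η) * P' j * D' j + a / η * (β * P j * D j) := by
    have h := hg j
    rw [hm, hm'] at h
    have h2 : (1 - β) * g j =
        (1 - β) * (-(a' / η) * P' j * D' j + a / η * (β * P j * D j)) := by
      field_simp at h ⊢
      linarith
    exact mul_left_cancel₀ hβ' h2
  have hcross : β * P j * D j * D' j ≤ k / 2 * (P j * D j ^ 2 + P' j * D' j ^ 2) := by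
    have h1 : β ^ 2 * P j * D' j ^ 2 ≤ k ^ 2 * P' j * D' j ^ 2 :=
      mul_le_mul_of_nonneg_right (hPk j) (sq_nonneg _)
    have h2 : 0 ≤ P j * (k * D j - β * D' j) ^ 2 := mul_nonneg (hP j) (sq_nonneg _)
    have h3 : 0 ≤ k * (k / 2 * (P j * D j ^ 2 + P' j * D' j ^ 2) - β * P j * D j * D' j) := by
      nlinarith
    linarith [nonneg_of_mul_nonneg_right h3 hk]
  have h4 := mul_le_mul_of_nonneg_left hcross (div_nonneg ha hη.le)
  rw [hgj]
  calc _ = -(a' / η) * (P' j * D' j ^ 2) + a / η * (β * P j * D j * D' j) := by ring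
    _ ≤ -(a' / η) * (P' j * D' j ^ 2) +
        a / η * (k / 2 * (P j * D j ^ 2 + P' j * D' j ^ 2)) := by linarith
    _ = _ := by ring

theorem preconditioned_momentum_descent {d : ℕ} {f : EuclideanSpace ℝ (Fin d) → ℝ}
    {grad : EuclideanSpace ℝ (Fin d) → EuclideanSpace ℝ (Fin d)} {H M ε : ℝ} (hH : 0 ≤ H)
    (hε : 0 < ε)
    (hf : ∀ u v s, HasDerivAt (fun s : ℝ => f (u + s • v)) ⟪grad (u + s • v), v⟫ s)
    (hlip : ∀ u v, f u ≤ M → f v ≤ M → ‖grad u - grad v‖ ≤ H * ‖u - v‖)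
    {u v : EuclideanSpace ℝ (Fin d)}
    {P P' D m m' : Fin d → ℝ} {β η a a' k A A' : ℝ}
    (hβ : β < 1) (hη : 0 < η) (ha : 0 ≤ a) (ha' : 0 ≤ a') (hk : 0 < k)
    (hP : ∀ j, 0 ≤ P j) (hP' : ∀ j, Real.sqrt ε ≤ P' j)
    (hPk : ∀ j, β ^ 2 * P j ≤ k ^ 2 * P' j)
    (hm : ∀ j, m j = -((1 - β) * a / η) * P j * D j)
    (hm' : ∀ j, m' j = -((1 - β) * a' / η) * P' j * v j)
    (hg : ∀ j, m' j = β * m j + (1 - β) * grad u j)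
    (hA : A = ∑ j, P j * D j ^ 2) (hA' : A' = ∑ j, P' j * v j ^ 2)
    (hstep : η * H / Real.sqrt ε ≤ a' - k * a)
    (hu : f u + k * a / (2 * η) * A < M) :
    f (u + v) + a' / (2 * η) * A' ≤ f u + k * a / (2 * η) * A := by
  have hsε : 0 < Real.sqrt ε := Real.sqrt_pos.2 hε
  have hA0 : 0 ≤ A := hA ▸ Finset.sum_nonneg fun j _ => mul_nonneg (hP j) (sq_nonneg _)
  have hA0' : 0 ≤ A' :=
    hA' ▸ Finset.sum_nonneg fun j _ => mul_nonneg (hsε.le.trans (hP' j)) (sq_nonneg _)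
  have hcoef : 0 ≤ k * a / (2 * η) := by positivity
  have hcoef' : 0 ≤ a' / (2 * η) := by positivity
  have hnorm : Real.sqrt ε * ‖v‖ ^ 2 ≤ A' := by
    rw [EuclideanSpace.real_norm_sq_eq, Finset.mul_sum, hA']
    exact Finset.sum_le_sum fun j _ => mul_le_mul_of_nonneg_right (hP' j) (sq_nonneg _)
  have hinner : ⟪grad u, v⟫ ≤ -(a' / η) * A' + k * a / (2 * η) * (A + A') := by
    have := sum_momentum_mul_le (D' := fun j => v j) hβ hη ha hk hP hPk hm hm' hg
    rw [hA, hA']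
    refine le_trans (le_of_eq ?_) this
    simp [PiLp.inner_apply, mul_comm]
  have hquad : H / 2 * ‖v‖ ^ 2 ≤ (a' - k * a) / (2 * η) * A' := by
    have h1 : H / 2 * ‖v‖ ^ 2 = η * H / Real.sqrt ε / (2 * η) * (Real.sqrt ε * ‖v‖ ^ 2) := by
      field_simp
    rw [h1]
    gcongr
    exact div_nonneg (le_trans (by positivity) hstep) (by positivity)
  have hY : ⟪grad u, v⟫ + H / 2 * ‖v‖ ^ 2 ≤ k * a / (2 * η) * A - a' / (2 * η) * A' := by
    have h2 : -(a' / η) * A' + k * a / (2 * η) * (A + A') + (a' - k * a) / (2 * η) * A' =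
        k * a / (2 * η) * A - a' / (2 * η) * A' := by field_simp; ring
    linarith
  have h3 := mul_nonneg hcoef hA0
  have h4 := mul_nonneg hcoef' hA0'
  have := descent_of_lipschitz_on_sublevel hH hf hlip (by linarith) hY (by linarith)
  linarith

theorem adam_energy_decrease {d : ℕ} {f : EuclideanSpace ℝ (Fin d) → ℝ}
    {grad : EuclideanSpace ℝ (Fin d) → EuclideanSpace ℝ (Fin d)} {H M ε β c η : ℝ}
    (hH : 0 ≤ H) (hε : 0 < ε) (hβ0 : 0 < β) (hβ : β < 1) (hc : 1 < c) (hcβ : c * β < 1)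
    (hη : 0 < η) (hfpos : ∀ u, 0 < f u)
    (hf : ∀ u v s, HasDerivAt (fun s : ℝ => f (u + s • v)) ⟪grad (u + s • v), v⟫ s)
    (hlip : ∀ u v, f u ≤ M → f v ≤ M → ‖grad u - grad v‖ ≤ H * ‖u - v‖)
    {w m : ℕ → EuclideanSpace ℝ (Fin d)} {P : ℕ → Fin d → ℝ} {a A U : ℕ → ℝ}
    (hM : M = f (w 1) / (1 - c * β))
    (ha : ∀ t, a t = (1 - β ^ t) / (1 - β))
    (hA : ∀ t, A t = ∑ j, P t j * (w (t + 1) - w t) j ^ 2)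
    (hU : ∀ t, U t = (f (w (t + 1)) + a t / (2 * η) * A t) / (1 - (c * β) ^ t))
    (hP : ∀ t j, Real.sqrt ε ≤ P t j)
    (hPstep : ∀ t, 1 ≤ t → ∀ j, β ^ 2 * P t j ≤
      ((1 - (c * β) ^ (t + 1)) / (1 - (c * β) ^ t) / c) ^ 2 * P (t + 1) j)
    (hm0 : m 0 = 0)
    (hm : ∀ t j, m (t + 1) j = β * m t j + (1 - β) * grad (w (t + 1)) j)
    (hmD : ∀ t, 1 ≤ t → ∀ j, m t j = -((1 - β ^ t) / η) * P t j * (w (t + 1) - w t) j)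
    (hstep : ∀ t, 1 ≤ t → η * H / Real.sqrt ε ≤
      a (t + 1) - (1 - (c * β) ^ (t + 1)) / (1 - (c * β) ^ t) / c * a t)
    {t : ℕ} (ht : 1 ≤ t) :
    U t ≤ M ∧ U (t + 1) ≤ U t - (1 - 1 / c) / (2 * η) * A t := by
  have hc0 : 0 < c := by linarith
  have hlam0 : 0 < c * β := by positivity
  have hb1 : 0 < 1 - β := by linarith
  have hsε : 0 < Real.sqrt ε := Real.sqrt_pos.2 hε
  have hpow : ∀ t, 1 ≤ t → 0 < 1 - (c * β) ^ t := fun t ht => by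
    have := pow_lt_one₀ hlam0.le hcβ (by omega : t ≠ 0); linarith
  have hanti : ∀ t, 1 - (c * β) ^ t ≤ 1 - (c * β) ^ (t + 1) := fun t => by
    have := pow_le_pow_of_le_one hlam0.le hcβ.le (Nat.le_add_right t 1); linarith
  have ha' : ∀ t, (1 - β) * a t = 1 - β ^ t := fun t => by
    rw [ha]; field_simp
  have ha1 : ∀ t, 1 ≤ t → 1 ≤ a t := fun t ht => by
    rw [ha, le_div_iff₀ hb1]
    have := pow_le_pow_of_le_one hβ0.le hβ.le ht; rw [pow_one] at this; linarith
  have hA0 : ∀ t, 0 ≤ A t := fun t =>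
    hA t ▸ Finset.sum_nonneg fun j _ => mul_nonneg (hsε.le.trans (hP t j)) (sq_nonneg _)
  have hadd : ∀ t, w t + (w (t + 1) - w t) = w (t + 1) := fun t => by abel
  have hM0 : 0 < M := hM ▸ div_pos (hfpos _) (by linarith)
  have step : ∀ t, 1 ≤ t → U t ≤ M → U (t + 1) ≤ U t - (1 - 1 / c) / (2 * η) * A t := by
    intro t ht hUM
    have hp := hpow t ht
    have hp' := hpow (t + 1) (by omega)
    set r := (1 - (c * β) ^ (t + 1)) / (1 - (c * β) ^ t) with hr
    have hr1 : 1 ≤ r := by rw [hr, one_le_div hp]; exact hanti t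
    have hUr : (1 - (c * β) ^ (t + 1)) * U t =
        r * (f (w (t + 1)) + a t / (2 * η) * A t) := by
      rw [hU, hr]; field_simp
    have hat := ha1 t ht
    have hq : 0 ≤ a t / (2 * η) * A t := mul_nonneg (by positivity) (hA0 t)
    have hcinv : 1 / c ≤ 1 := by rw [div_le_one hc0]; exact hc.le
    have hfr : f (w (t + 1)) ≤ r * f (w (t + 1)) := by nlinarith [hfpos (w (t + 1))]
    have heq : r / c * a t / (2 * η) * A t = 1 / c * (r * (a t / (2 * η) * A t)) := by
      field_simp
    have hlt : f (w (t + 1)) + r / c * a t / (2 * η) * A t < M := by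
      have h1 : (1 - (c * β) ^ (t + 1)) * U t ≤ (1 - (c * β) ^ (t + 1)) * M :=
        mul_le_mul_of_nonneg_left hUM hp'.le
      have h2 : (1 - (c * β) ^ (t + 1)) * M < M := by
        have : 0 < (c * β) ^ (t + 1) := by positivity
        nlinarith
      have h3 : 1 / c * (r * (a t / (2 * η) * A t)) ≤ r * (a t / (2 * η) * A t) :=
        mul_le_of_le_one_left (mul_nonneg (by linarith) hq) hcinv
      rw [heq]
      linarith
    have hdesc := preconditioned_momentum_descent (u := w (t + 1)) (v := w (t + 1 + 1) - w (t + 1))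
      (P := P t) (P' := P (t + 1)) (D := fun j => (w (t + 1) - w t) j) (m := fun j => m t j)
      (m' := fun j => m (t + 1) j) (a' := a (t + 1)) (A' := A (t + 1)) hH hε hf hlip hβ hη
      (by linarith) (by linarith [ha1 (t + 1) (by omega)]) (by positivity : 0 < r / c)
      (fun j => hsε.le.trans (hP t j)) (hP (t + 1)) (hPstep t ht)
      (fun j => by rw [ha']; exact hmD t ht j)
      (fun j => by rw [ha']; exact hmD (t + 1) (by omega) j) (hm t) (hA t) (hA (t + 1))
      (hstep t ht) hlt
    rw [hadd, heq] at hdesc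
    rw [hU (t + 1), div_le_iff₀ hp']
    have h5 : (U t - (1 - 1 / c) / (2 * η) * A t) * (1 - (c * β) ^ (t + 1)) =
        r * f (w (t + 1)) + r * (a t / (2 * η) * A t) -
          (1 - 1 / c) * ((1 - (c * β) ^ (t + 1)) * (1 / (2 * η) * A t)) := by
      rw [sub_mul, mul_comm (U t), hUr]; ring
    rw [h5]
    have h6 : (1 - (c * β) ^ (t + 1)) * (1 / (2 * η) * A t) ≤ r * (a t / (2 * η) * A t) := by
      have h7 : 0 ≤ 1 / (2 * η) * A t := mul_nonneg (by positivity) (hA0 t)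
      have h8 : 1 - (c * β) ^ (t + 1) ≤ r * a t := by
        have : 0 < (c * β) ^ (t + 1) := by positivity
        nlinarith
      calc _ ≤ r * a t * (1 / (2 * η) * A t) := mul_le_mul_of_nonneg_right h8 h7
        _ = _ := by ring
    have h9 := mul_le_mul_of_nonneg_left h6 (by linarith : 0 ≤ 1 - 1 / c)
    linarith
  have base : U 1 ≤ M := by
    have h1 : η * H / Real.sqrt ε ≤ 1 := by
      refine (hstep 1 le_rfl).trans ?_
      have : a (1 + 1) - (1 - (c * β) ^ (1 + 1)) / (1 - (c * β) ^ 1) / c * a 1 = 1 - 1 / c := by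
        have h2 : (1 - (c * β) ^ (1 + 1)) / (1 - (c * β) ^ 1) = 1 + c * β := by
          rw [div_eq_iff (by linarith [hpow 1 le_rfl])]; ring
        have h3 : (1 - β ^ (1 + 1)) / (1 - β) = 1 + β := by
          rw [div_eq_iff hb1.ne']; ring
        rw [ha, ha, h2, h3, pow_one, div_self hb1.ne']
        field_simp
        ring
      rw [this]
      have : 0 < 1 / c := by positivity
      linarith
    have haone : a 1 = 1 := by rw [ha, pow_one, div_self hb1.ne']
    have hdesc := preconditioned_momentum_descent (u := w 1) (v := w (1 + 1) - w 1)
      (P := fun _ => 0) (P' := P 1) (D := fun _ => 0) (m := fun j => m 0 j)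
      (m' := fun j => m 1 j) (a := 0) (a' := a 1) (A := 0) (A' := A 1) (k := 1)
      hH hε hf hlip hβ hη le_rfl (by linarith) one_pos
      (fun j => le_rfl) (hP 1) (fun j => by
        have := hsε.le.trans (hP 1 j); simpa using this)
      (fun j => by simp [hm0])
      (fun j => by rw [ha']; exact hmD 1 le_rfl j) (hm 0) (by simp) (hA 1)
      (by rw [haone]; linarith) (by
        have h3 : 0 < 1 - c * β := by linarith
        rw [hM, lt_div_iff₀ h3]
        nlinarith [hfpos (w 1), mul_pos hlam0 (hfpos (w 1))])
    rw [hadd] at hdesc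
    rw [hU, hM, pow_one]
    apply div_le_div_of_nonneg_right _ (by linarith)
    linarith
  have hall : U t ≤ M := by
    induction t, ht using Nat.le_induction with
    | base => exact base
    | succ t ht ih =>
      have h1 := step t ht ih
      have h2 : 0 ≤ (1 - 1 / c) / (2 * η) * A t := by
        have : 1 / c ≤ 1 := by rw [div_le_one hc0]; exact hc.le
        exact mul_nonneg (div_nonneg (by linarith) (by positivity)) (hA0 t)
      linarith
  exact ⟨hall, step t ht hall⟩

theorem preconditioner_step {lam x y ε : ℝ} (hlam0 : 0 < lam) (hlam : lam < 1) (hε : 0 < ε)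
    (hx : 0 ≤ x) (hxy : lam ^ 4 * x ≤ y) {t : ℕ} (ht : 1 ≤ t) :
    lam ^ 2 * Real.sqrt (x / (1 - (lam ^ 4) ^ t) + ε) ≤
      ((1 - lam ^ (t + 1)) / (1 - lam ^ t)) ^ 2 *
        Real.sqrt (y / (1 - (lam ^ 4) ^ (t + 1)) + ε) := by
  have e1 : (lam ^ 4) ^ t = (lam ^ t) ^ 4 := by rw [← pow_mul, ← pow_mul, mul_comm]
  have e2 : (lam ^ 4) ^ (t + 1) = (lam ^ (t + 1)) ^ 4 := by rw [← pow_mul, ← pow_mul, mul_comm]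
  rw [e1, e2]
  have hb0 : 0 < lam ^ t := by positivity
  have hb1 : lam ^ t < 1 := pow_lt_one₀ hlam0.le hlam (by omega)
  have ha0 : 0 < lam ^ (t + 1) := by positivity
  have hab : lam ^ (t + 1) ≤ lam ^ t := pow_le_pow_of_le_one hlam0.le hlam.le (Nat.le_add_right t 1)
  set a := lam ^ (t + 1)
  set b := lam ^ t
  set r := (1 - a) / (1 - b) with hr
  have hb : 0 < 1 - b := by linarith
  have hr1 : 1 ≤ r := by rw [hr, one_le_div hb]; linarith
  have hb4 : b ^ 4 < 1 := pow_lt_one₀ hb0.le hb1 (by norm_num)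
  have ha4 : a ^ 4 < 1 := pow_lt_one₀ ha0.le (hab.trans_lt hb1) (by norm_num)
  have hy : 0 ≤ y := le_trans (by positivity) hxy
  have hratio : 1 - a ^ 4 ≤ r * (1 - b ^ 4) := by
    have h1 : r * (1 - b ^ 4) = (1 - a) * ((1 + b) * (1 + b ^ 2)) := by
      rw [hr]; field_simp; ring
    have h2 : 1 - a ^ 4 = (1 - a) * ((1 + a) * (1 + a ^ 2)) := by ring
    rw [h1, h2]
    have : 0 ≤ 1 - a := by linarith
    gcongr
  have hr4 : r ≤ r ^ 4 := le_self_pow₀ hr1 (by norm_num)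
  have hmain : lam ^ 4 * (x / (1 - b ^ 4) + ε) ≤ r ^ 4 * (y / (1 - a ^ 4) + ε) := by
    have hl4 : lam ^ 4 ≤ 1 := pow_le_one₀ hlam0.le hlam.le
    have h3 : lam ^ 4 * (x / (1 - b ^ 4)) ≤ r ^ 4 * (y / (1 - a ^ 4)) := by
      have h4 : lam ^ 4 * (x / (1 - b ^ 4)) ≤ y / (1 - b ^ 4) := by
        rw [← mul_div_assoc]
        exact div_le_div_of_nonneg_right hxy (by linarith)
      have h5 : y / (1 - b ^ 4) ≤ r * (y / (1 - a ^ 4)) := by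
        rw [← mul_div_assoc, div_le_div_iff₀ (by linarith) (by linarith)]
        nlinarith [mul_le_mul_of_nonneg_left hratio hy]
      have h6 : r * (y / (1 - a ^ 4)) ≤ r ^ 4 * (y / (1 - a ^ 4)) :=
        mul_le_mul_of_nonneg_right hr4 (div_nonneg hy (by linarith))
      linarith
    have h7 : lam ^ 4 * ε ≤ r ^ 4 * ε := mul_le_mul_of_nonneg_right (by linarith) hε.le
    linarith
  have hX : 0 ≤ x / (1 - b ^ 4) + ε := add_nonneg (div_nonneg hx (by linarith)) hε.le
  have hY : 0 ≤ y / (1 - a ^ 4) + ε := add_nonneg (div_nonneg hy (by linarith)) hε.le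
  have e3 : lam ^ 2 * Real.sqrt (x / (1 - b ^ 4) + ε) =
      Real.sqrt (lam ^ 4 * (x / (1 - b ^ 4) + ε)) := by
    rw [Real.sqrt_mul (by positivity), show lam ^ 4 = (lam ^ 2) ^ 2 by ring,
      Real.sqrt_sq (by positivity)]
  have e4 : r ^ 2 * Real.sqrt (y / (1 - a ^ 4) + ε) =
      Real.sqrt (r ^ 4 * (y / (1 - a ^ 4) + ε)) := by
    rw [Real.sqrt_mul (by positivity), show r ^ 4 = (r ^ 2) ^ 2 by ring,
      Real.sqrt_sq (by positivity)]
  rw [e3, e4]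
  exact Real.sqrt_le_sqrt hmain

theorem exponential_average_le {v g : ℕ → ℝ} {b B : ℝ} (hb0 : 0 ≤ b) (hb : b ≤ 1)
    (h0 : v 0 = 0) (hv : ∀ t, v (t + 1) = b * v t + (1 - b) * g (t + 1))
    (hg : ∀ t, 1 ≤ t → g t ≤ B) (t : ℕ) : v t ≤ B * (1 - b ^ t) := by
  induction t with
  | zero => simp [h0]
  | succ t ih =>
    rw [hv, pow_succ]
    have h1 := mul_le_mul_of_nonneg_left ih hb0
    have h2 := mul_le_mul_of_nonneg_left (hg (t + 1) (by omega)) (sub_nonneg.2 hb)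
    nlinarith

theorem energy_le_div {U A l : ℕ → ℝ} {κ k M C₁ C₂ : ℝ} (hκ : 0 < κ) (hk : 0 < k)
    (hC₁ : 0 ≤ C₁) (hC₂ : 0 < C₂)
    (hA : ∀ t, 0 ≤ A t) (hUpos : ∀ t, 1 ≤ t → 0 < U t) (hUM : ∀ t, 1 ≤ t → U t ≤ M)
    (hU : ∀ t, 1 ≤ t → U (t + 1) ≤ U t - κ * A t)
    (hl : ∀ t, 1 ≤ t → l (t + 1) ^ 2 ≤ C₁ * (A t + A (t + 1)))
    (hUl : ∀ t, 1 ≤ t → U t ≤ C₂ * (l (t + 1) + A t))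
    (hAU : ∀ t, 1 ≤ t → k * A t ≤ U t) :
    ∃ C, 0 < C ∧ ∀ t : ℕ, 4 ≤ t → U t ≤ C / t := by
  have hM : 0 < M := (hUpos 1 le_rfl).trans_le (hUM 1 le_rfl)
  set Q := 2 * C₂ ^ 2 * (C₁ + M / k) with hQ
  have hQ0 : 0 < Q := by positivity
  refine le_div_of_two_step_quadratic_decrease (κ := κ / Q) (by positivity) hUpos ?_
  intro t ht
  have hAM : A t ≤ M / k := by
    rw [le_div_iff₀ hk]; linarith [hAU t ht, hUM t ht]
  have h1 : U t ^ 2 ≤ Q * (A t + A (t + 1)) := by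
    have h2 : U t ^ 2 ≤ (C₂ * (l (t + 1) + A t)) ^ 2 :=
      pow_le_pow_left₀ (hUpos t ht).le (hUl t ht) 2
    have h3 : (l (t + 1) + A t) ^ 2 ≤ 2 * (l (t + 1) ^ 2 + A t ^ 2) := by
      nlinarith [sq_nonneg (l (t + 1) - A t)]
    have h4 : A t ^ 2 ≤ M / k * (A t + A (t + 1)) := by
      have := mul_le_mul_of_nonneg_right hAM (hA t)
      have : 0 ≤ M / k * A (t + 1) := mul_nonneg (by positivity) (hA _)
      nlinarith
    calc U t ^ 2 ≤ C₂ ^ 2 * (l (t + 1) + A t) ^ 2 := by rw [← mul_pow]; exact h2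
      _ ≤ C₂ ^ 2 * (2 * (C₁ * (A t + A (t + 1)) + M / k * (A t + A (t + 1)))) := by
        have := hl t ht
        gcongr
        linarith
      _ = Q * (A t + A (t + 1)) := by rw [hQ]; ring
  have h5 : κ / Q * U t ^ 2 ≤ κ * (A t + A (t + 1)) := by
    calc κ / Q * U t ^ 2 ≤ κ / Q * (Q * (A t + A (t + 1))) := by gcongr
      _ = _ := by field_simp
  have h6 := hU t ht
  have h7 := hU (t + 1) (by omega)
  have h8 : t + 1 + 1 = t + 2 := rfl
  rw [h8] at h7
  linarith

theorem exists_momentum_norm_le {E : Type*} [NormedAddCommGroup E] [NormedSpace ℝ E]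
    {m g : ℕ → E} {l δ : ℕ → ℝ} {β C K : ℝ} (hβ0 : 0 < β) (hβ : β < 1) (hC : 0 ≤ C)
    (hm : ∀ t, m (t + 1) = β • m t + (1 - β) • g (t + 1))
    (hl : ∀ t, 0 < l t) (hg : ∀ t, 1 ≤ t → ‖g t‖ ≤ C * l t)
    (hδ : Tendsto δ atTop (𝓝 0))
    (hlδ : ∀ t, 1 ≤ t → l t * Real.exp (-(K * δ t)) ≤ l (t + 1)) :
    ∃ K', 0 < K' ∧ ∃ T : ℕ, ∀ t, T ≤ t → ‖m t‖ ≤ K' * l t := by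
  set ρ := (1 + β) / 2 with hρ
  have hlim : Tendsto (fun t => Real.exp (-(K * δ t))) atTop (𝓝 1) := by
    have := (Real.continuous_exp.tendsto 0).comp (by simpa using (hδ.const_mul K).neg)
    simpa [Function.comp_def] using this
  obtain ⟨T, hT⟩ := eventually_atTop.1
    (hlim.eventually (lt_mem_nhds (by rw [hρ]; linarith : ρ < 1)))
  set S := max T 1
  have hρ0 : 0 < ρ := by rw [hρ]; linarith
  have hβρ : β / ρ < 1 := by rw [div_lt_one hρ0]; rw [hρ]; linarith
  set K' := max (‖m S‖ / l S) ((C + 1) / (1 - β / ρ)) with hK'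
  have hK1 : (C + 1) / (1 - β / ρ) ≤ K' := le_max_right _ _
  have hK0 : 0 < K' := lt_of_lt_of_le (div_pos (by linarith) (by linarith)) hK1
  refine ⟨K', hK0, S, fun t ht => ?_⟩
  induction t, ht using Nat.le_induction with
  | base =>
    rw [← div_le_iff₀ (hl S)]
    exact le_max_left _ _
  | succ t ht ih =>
    have ht1 : 1 ≤ t := (le_max_right T 1).trans ht
    have h1 : ρ * l t ≤ l (t + 1) := by
      have := (hT t ((le_max_left T 1).trans ht)).le
      nlinarith [hlδ t ht1, hl t]
    have h2 : ‖m (t + 1)‖ ≤ β * ‖m t‖ + ‖g (t + 1)‖ := by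
      rw [hm]
      refine (norm_add_le _ _).trans ?_
      rw [norm_smul, norm_smul, Real.norm_of_nonneg hβ0.le, Real.norm_of_nonneg (by linarith)]
      nlinarith [norm_nonneg (g (t + 1))]
    have h3 := hg (t + 1) (by omega)
    have h4 : β * (K' * l t) ≤ β / ρ * K' * l (t + 1) := by
      calc β * (K' * l t) = β / ρ * K' * (ρ * l t) := by field_simp
        _ ≤ _ := by gcongr
    have h5 : C ≤ K' * (1 - β / ρ) := by
      rw [div_le_iff₀ (by linarith)] at hK1; linarith
    have h6 := mul_le_mul_of_nonneg_left ih hβ0.le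
    nlinarith [mul_le_mul_of_nonneg_right h5 (hl (t + 1)).le]

theorem exists_norm_le_log {E : Type*} [NormedAddCommGroup E] {w : ℕ → E} {C : ℝ} (hC : 0 < C)
    {T : ℕ} (hT : 2 ≤ T) (hw : ∀ t : ℕ, T ≤ t → ‖w (t + 1) - w t‖ ≤ C / t) :
    ∃ c, 0 < c ∧ ∀ t : ℕ, T ≤ t → ‖w t‖ ≤ c * Real.log t := by
  have hlog2 : 0 < Real.log 2 := Real.log_pos (by norm_num)
  have key : ∀ t : ℕ, T ≤ t → ‖w t‖ ≤ ‖w T‖ + 2 * C * Real.log t := by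
    intro t ht
    induction t, ht using Nat.le_induction with
    | base =>
      have : 0 ≤ Real.log T := Real.log_natCast_nonneg T
      have : 0 ≤ 2 * C * Real.log T := by positivity
      linarith
    | succ t ht ih =>
      have ht1 : (1 : ℝ) ≤ t := by exact_mod_cast (by omega : 1 ≤ t)
      have h1 : ‖w (t + 1)‖ ≤ ‖w t‖ + ‖w (t + 1) - w t‖ := by
        simpa using norm_add_le (w t) (w (t + 1) - w t)
      have h2 := hw t ht
      have h3 : 1 / (2 * (t : ℝ)) ≤ Real.log (t + 1) - Real.log t := by
        have h4 := Real.one_sub_inv_le_log_of_pos (x := ((t : ℝ) + 1) / t) (by positivity)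
        rw [Real.log_div (by positivity) (by positivity)] at h4
        refine le_trans ?_ h4
        have h5 : 1 - (((t : ℝ) + 1) / t)⁻¹ = 1 / (t + 1) := by field_simp; ring
        rw [h5]
        exact one_div_le_one_div_of_le (by positivity) (by linarith)
      have h6 : C / t = 2 * C * (1 / (2 * (t : ℝ))) := by field_simp
      have h7 : 2 * C * (1 / (2 * (t : ℝ))) ≤ 2 * C * (Real.log (t + 1) - Real.log t) := by
        gcongr
      push_cast
      linarith
  refine ⟨‖w T‖ / Real.log 2 + 2 * C, by positivity, fun t ht => ?_⟩
  have h1 : Real.log 2 ≤ Real.log t :=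
    Real.log_le_log (by norm_num) (by exact_mod_cast hT.trans ht)
  have h2 : ‖w T‖ ≤ ‖w T‖ / Real.log 2 * Real.log t := by
    calc ‖w T‖ = ‖w T‖ / Real.log 2 * Real.log 2 := by field_simp
      _ ≤ _ := by gcongr
  have := key t ht
  linarith

theorem norm_le_mul_norm_of_coord {d : ℕ} {u v : EuclideanSpace ℝ (Fin d)} {K : ℝ} (hK : 0 ≤ K)
    (h : ∀ j, |u j| ≤ K * |v j|) : ‖u‖ ≤ K * ‖v‖ := by
  apply le_of_sq_le_sq _ (by positivity)
  rw [mul_pow, EuclideanSpace.real_norm_sq_eq, EuclideanSpace.real_norm_sq_eq, Finset.mul_sum]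
  refine Finset.sum_le_sum fun j _ => ?_
  have := pow_le_pow_left₀ (abs_nonneg _) (h j) 2
  rwa [mul_pow, sq_abs, sq_abs] at this

theorem norm_average_smul_le {E : Type*} [NormedAddCommGroup E] [NormedSpace ℝ E] {N : ℕ}
    {x : Fin N → E} {c l : Fin N → ℝ} {K X : ℝ} (hx : ∀ i, ‖x i‖ ≤ X)
    (hc : ∀ i, |c i| ≤ K * l i) :
    ‖(1 / (N : ℝ)) • ∑ i, c i • x i‖ ≤ K * X * ((1 / (N : ℝ)) * ∑ i, l i) := by
  rw [norm_smul, Real.norm_of_nonneg (by positivity)]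
  have h : ‖∑ i, c i • x i‖ ≤ K * X * ∑ i, l i := by
    refine (norm_sum_le _ _).trans ?_
    rw [Finset.mul_sum]
    refine Finset.sum_le_sum fun i _ => ?_
    rw [norm_smul, Real.norm_eq_abs]
    calc |c i| * ‖x i‖ ≤ K * l i * X :=
          mul_le_mul (hc i) (hx i) (norm_nonneg _) ((abs_nonneg _).trans (hc i))
      _ = _ := by ring
  calc _ ≤ 1 / (N : ℝ) * (K * X * ∑ i, l i) := by gcongr
    _ = _ := by ring

theorem le_inner_neg_average_smul {E : Type*} [NormedAddCommGroup E] [InnerProductSpace ℝ E]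
    {N : ℕ} {x : Fin N → E} {v : E} {c l : Fin N → ℝ} {k : ℝ} (hv : ∀ i, 1 ≤ ⟪v, x i⟫)
    (hc0 : ∀ i, c i ≤ 0) (hc : ∀ i, k * l i ≤ -c i) :
    k * ((1 / (N : ℝ)) * ∑ i, l i) ≤ ⟪-((1 / (N : ℝ)) • ∑ i, c i • x i), v⟫ := by
  rw [← smul_neg, real_inner_smul_left, inner_neg_left, sum_inner]
  have h : k * ∑ i, l i ≤ -∑ i, ⟪c i • x i, v⟫ := by
    rw [Finset.mul_sum, ← Finset.sum_neg_distrib]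
    refine Finset.sum_le_sum fun i _ => ?_
    rw [real_inner_smul_left, real_inner_comm]
    nlinarith [hv i, hc0 i, hc i]
  calc _ = 1 / (N : ℝ) * (k * ∑ i, l i) := by ring
    _ ≤ _ := by gcongr

theorem hasDerivAt_average_loss_line {E : Type*} [NormedAddCommGroup E] [InnerProductSpace ℝ E]
    {N : ℕ} {x : Fin N → E} {ℓ ℓ' : ℝ → ℝ} (hdiff : ∀ s, HasDerivAt ℓ (ℓ' s) s) (u v : E) (s : ℝ) :
    HasDerivAt (fun s : ℝ => (1 / (N : ℝ)) * ∑ i, ℓ ⟪u + s • v, x i⟫)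
      ⟪(1 / (N : ℝ)) • ∑ i, ℓ' ⟪u + s • v, x i⟫ • x i, v⟫ s := by
  have hi : ∀ i, HasDerivAt (fun s : ℝ => ℓ ⟪u + s • v, x i⟫)
      (ℓ' ⟪u + s • v, x i⟫ * ⟪v, x i⟫) s := by
    intro i
    have h : HasDerivAt (fun s : ℝ => ⟪u + s • v, x i⟫) ⟪v, x i⟫ s := by
      have h0 : (fun s : ℝ => ⟪u + s • v, x i⟫) = fun s : ℝ => ⟪u, x i⟫ + s * ⟪v, x i⟫ := by
        funext s
        rw [inner_add_left, real_inner_smul_left]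
      rw [h0]
      exact (((hasDerivAt_id s).mul_const ⟪v, x i⟫).const_add ⟪u, x i⟫).congr_deriv (one_mul _)
    exact (hdiff _).comp s h
  refine ((HasDerivAt.fun_sum fun i (_ : i ∈ Finset.univ) => hi i).const_mul
    (1 / (N : ℝ))).congr_deriv ?_
  rw [real_inner_smul_left, sum_inner]
  congr 1
  refine Finset.sum_congr rfl fun i _ => ?_
  rw [real_inner_smul_left, real_inner_comm v (x i)]

theorem average_loss_mul_exp_neg_le {E : Type*} [NormedAddCommGroup E] [InnerProductSpace ℝ E]
    {N : ℕ} {x : Fin N → E} {ℓ : ℝ → ℝ} {K X s₀ : ℝ} (hK : 0 ≤ K) (hx : ∀ i, ‖x i‖ ≤ X)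
    (hℓpos : ∀ s, 0 < ℓ s)
    (hℓ : ∀ a b, s₀ ≤ a → ℓ a * Real.exp (-(K * |b - a|)) ≤ ℓ b) {u v : E}
    (hu : ∀ i, s₀ ≤ ⟪u, x i⟫) :
    (1 / (N : ℝ)) * ∑ i, ℓ ⟪u, x i⟫ * Real.exp (-(K * X * ‖v - u‖)) ≤
      (1 / (N : ℝ)) * ∑ i, ℓ ⟪v, x i⟫ := by
  refine mul_le_mul_of_nonneg_left (Finset.sum_le_sum fun i _ => ?_) (by positivity)
  refine le_trans (mul_le_mul_of_nonneg_left ?_ (hℓpos _).le) (hℓ _ _ (hu i))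
  apply Real.exp_le_exp.2
  have h1 : |⟪v, x i⟫ - ⟪u, x i⟫| ≤ X * ‖v - u‖ := by
    rw [← inner_sub_left]
    refine (abs_real_inner_le_norm _ _).trans ?_
    rw [mul_comm]
    exact mul_le_mul_of_nonneg_right (hx i) (norm_nonneg _)
  have := mul_le_mul_of_nonneg_left h1 hK
  linarith

theorem exists_log_le_norm {E : Type*} [NormedAddCommGroup E] [InnerProductSpace ℝ E]
    {ℓ : ℝ → ℝ} {p B X s₀ : ℝ} {y : E} {w : ℕ → E} {T : ℕ} (hp : 0 < p) (hB : 0 < B) (hX : 0 < X)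
    (hy : ‖y‖ ≤ X) (hw : ∀ t, T ≤ t → s₀ ≤ ⟪w t, y⟫)
    (hℓ : ∀ s, s₀ ≤ s → p * Real.exp (-s) ≤ ℓ s)
    (hB' : ∀ t, T ≤ t → ℓ ⟪w t, y⟫ ≤ B / t) :
    ∃ c, 0 < c ∧ ∃ T', ∀ t : ℕ, T' ≤ t → c * Real.log t ≤ ‖w t‖ := by
  obtain ⟨T', hT'⟩ := eventually_atTop.1
    ((Real.tendsto_log_atTop.comp tendsto_natCast_atTop_atTop).eventually_ge_atTop
      (2 * Real.log (B / p)))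
  refine ⟨1 / (2 * X), by positivity, max T (max T' 1), fun t ht => ?_⟩
  have htT : T ≤ t := (le_max_left _ _).trans ht
  have htT' : T' ≤ t := (le_max_left _ _).trans ((le_max_right _ _).trans ht)
  have ht1 : 1 ≤ t := (le_max_right _ _).trans ((le_max_right _ _).trans ht)
  have ht0 : (0 : ℝ) < t := by exact_mod_cast ht1
  have h1 : Real.exp (-⟪w t, y⟫) ≤ B / p / t := by
    have := (hℓ _ (hw t htT)).trans (hB' t htT)
    rw [div_right_comm, le_div_iff₀ hp]
    linarith
  have h2 : -⟪w t, y⟫ ≤ Real.log (B / p) - Real.log t := by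
    rw [← Real.log_div (by positivity) (by positivity)]
    exact (Real.le_log_iff_exp_le (by positivity)).2 h1
  have h3 : 2 * Real.log (B / p) ≤ Real.log t := hT' t htT'
  have h4 : ⟪w t, y⟫ ≤ ‖w t‖ * X :=
    (real_inner_le_norm _ _).trans (mul_le_mul_of_nonneg_left hy (norm_nonneg _))
  rw [one_div_mul_eq_div, div_le_iff₀ (by positivity)]
  linarith

set_option maxHeartbeats 2000000 in
theorem stmt18
    {d N : ℕ} (hN : 1 ≤ N)
    (x : Fin N → EuclideanSpace ℝ (Fin d))
    (ℓ ℓ' : ℝ → ℝ)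
    (hdiff : ∀ s : ℝ, HasDerivAt ℓ (ℓ' s) s)
    (L : EuclideanSpace ℝ (Fin d) → ℝ)
    (hLdef : ∀ w : EuclideanSpace ℝ (Fin d), L w = (1 / (N : ℝ)) * ∑ i, ℓ ⟪w, x i⟫)
    (gradL : EuclideanSpace ℝ (Fin d) → EuclideanSpace ℝ (Fin d))
    (hgraddef : ∀ w : EuclideanSpace ℝ (Fin d),
      gradL w = (1 / (N : ℝ)) • ∑ i, ℓ' ⟪w, x i⟫ • x i)
    (hsep : ∃ u : EuclideanSpace ℝ (Fin d), ∀ i, 0 < ⟪u, x i⟫)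
    (σmax : ℝ) (hσpos : 0 < σmax)
    (hσ : ∀ c : Fin N → ℝ, ‖∑ i, c i • x i‖ ≤ σmax * Real.sqrt (∑ i, (c i) ^ 2))
    (wmax : EuclideanSpace ℝ (Fin d))
    (hwmax : ∀ i, 1 ≤ ⟪wmax, x i⟫)
    (hwmaxmin : ∀ v : EuclideanSpace ℝ (Fin d), (∀ i, 1 ≤ ⟪v, x i⟫) → ‖wmax‖ ≤ ‖v‖)
    (hℓpos : ∀ s : ℝ, 0 < ℓ s) (hℓ'neg : ∀ s : ℝ, ℓ' s < 0)
    (hℓtop : Tendsto ℓ atTop (𝓝 0))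
    (hℓ'top : Tendsto ℓ' atTop (𝓝 0))
    (hℓ'bot : Filter.limsup ℓ' atBot < 0)
    (μp μm xp xm : ℝ) (hμp : 0 < μp) (hμm : 0 < μm)
    (htailp : ∀ s : ℝ, xp < s → -ℓ' s ≤ (1 + Real.exp (-μp * s)) * Real.exp (-s))
    (htailm : ∀ s : ℝ, xm < s → (1 - Real.exp (-μm * s)) * Real.exp (-s) ≤ -ℓ' s)
    (hloc : ∀ s : ℝ, ∃ H : ℝ, 0 < H ∧
      ∀ a b : ℝ, s ≤ a → s ≤ b → |ℓ' a - ℓ' b| ≤ H * |a - b|)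
    (η β₁ β₂ ε cA : ℝ) (hη : 0 < η) (hε : 0 < ε)
    (hβ₁pos : 0 < β₁) (hβ₁lt : β₁ < 1) (hcA : 1 < cA) (hcβ : cA * β₁ < 1)
    (hβ₂ : β₂ = (cA * β₁) ^ 4)
    (w m ν : ℕ → EuclideanSpace ℝ (Fin d))
    (hm0 : m 0 = 0) (hν0 : ν 0 = 0) (hw0 : w 0 = w 1)
    (hmrec : ∀ t : ℕ, 1 ≤ t → ∀ j, m t j = β₁ * m (t - 1) j + (1 - β₁) * gradL (w t) j)
    (hνrec : ∀ t : ℕ, 1 ≤ t → ∀ j, ν t j = β₂ * ν (t - 1) j + (1 - β₂) * (gradL (w t) j) ^ 2)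
    (hwrec : ∀ t : ℕ, 1 ≤ t → ∀ j,
      w (t + 1) j = w t j - η * (m t j / (1 - β₁ ^ t)) / Real.sqrt (ν t j / (1 - β₂ ^ t) + ε))
    (H_L : ℝ) (hH_Lpos : 0 < H_L)
    (hH_L : ∀ u v : EuclideanSpace ℝ (Fin d),
      L u ≤ L (w 1) / (1 - cA * β₁) → L v ≤ L (w 1) / (1 - cA * β₁) →
      ‖gradL u - gradL v‖ ≤ H_L * ‖u - v‖)
    (hηle : η ≤ (Real.sqrt ε / H_L) *
      sInf {y : ℝ | ∃ t : ℕ, 2 ≤ t ∧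
        y = (1 - β₁ ^ t) / (1 - β₁) -
          ((1 - β₁ ^ (t - 1)) / (cA * (1 - β₁))) *
            ((1 - (cA * β₁) ^ t) / (1 - (cA * β₁) ^ (t - 1)))})
    :
    ∃ c₁ c₂ c₃ c₄ c₅ c₆ : ℝ, 0 < c₁ ∧ 0 < c₂ ∧ 0 < c₃ ∧ 0 < c₄ ∧ 0 < c₅ ∧ 0 < c₆ ∧
      ∃ T : ℕ, ∀ t : ℕ, T ≤ t →
        (c₁ / t ≤ L (w t) ∧ L (w t) ≤ c₂ / t) ∧
        (c₃ * Real.log t ≤ ‖w t‖ ∧ ‖w t‖ ≤ c₄ * Real.log t) ∧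
        (c₅ / t ≤ ‖w (t + 1) - w t‖ ∧ ‖w (t + 1) - w t‖ ≤ c₆ / t) := by
  have hN0 : (0 : ℝ) < N := by exact_mod_cast hN
  have hLfun : L = fun u => (1 / (N : ℝ)) * ∑ i, ℓ ⟪u, x i⟫ := funext hLdef
  have hgfun : gradL = fun u => (1 / (N : ℝ)) • ∑ i, ℓ' ⟪u, x i⟫ • x i := funext hgraddef
  let i₀ : Fin N := ⟨0, hN⟩
  have hLpos : ∀ u, 0 < L u := fun u => by
    rw [hLdef]
    exact mul_pos (by positivity)
      (Finset.sum_pos (fun i _ => hℓpos _) ⟨i₀, Finset.mem_univ _⟩)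
  have hℓL : ∀ u i, ℓ ⟪u, x i⟫ ≤ N * L u := fun u i => by
    rw [hLdef, ← mul_assoc, mul_one_div_cancel hN0.ne', one_mul]
    exact Finset.single_le_sum (f := fun i => ℓ ⟪u, x i⟫) (fun i _ => (hℓpos _).le)
      (Finset.mem_univ i)
  have hlam0 : 0 < cA * β₁ := by positivity
  have hb1 : 0 < 1 - β₁ := by linarith
  have hsε : 0 < Real.sqrt ε := Real.sqrt_pos.2 hε
  have hβ₂0 : 0 < β₂ := by rw [hβ₂]; positivity
  have hβ₂1 : β₂ < 1 := by rw [hβ₂]; exact pow_lt_one₀ hlam0.le hcβ (by norm_num)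
  have hpow₂ : ∀ t, 1 ≤ t → 0 < 1 - β₂ ^ t := fun t ht => by
    have := pow_lt_one₀ hβ₂0.le hβ₂1 (by omega : t ≠ 0); linarith
  have hpow₂' : ∀ t, 0 ≤ 1 - β₂ ^ t := fun t => by
    have := pow_le_one₀ hβ₂0.le hβ₂1.le (n := t); linarith
  have hpow₁ : ∀ t, 1 ≤ t → 1 - β₁ ≤ 1 - β₁ ^ t := fun t ht => by
    have := pow_le_pow_of_le_one hβ₁pos.le hβ₁lt.le ht
    rw [pow_one] at this; linarith
  have hm : ∀ t j, m (t + 1) j = β₁ * m t j + (1 - β₁) * gradL (w (t + 1)) j := fun t j => by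
    simpa using hmrec (t + 1) (by omega) j
  have hν : ∀ t j, ν (t + 1) j = β₂ * ν t j + (1 - β₂) * (gradL (w (t + 1)) j) ^ 2 :=
    fun t j => by simpa using hνrec (t + 1) (by omega) j
  have hνnonneg : ∀ t j, 0 ≤ ν t j := by
    intro t j
    induction t with
    | zero => simp [hν0]
    | succ t ih =>
      rw [hν]
      exact add_nonneg (mul_nonneg hβ₂0.le ih) (mul_nonneg (by linarith) (sq_nonneg _))
  obtain ⟨P, hPdef⟩ : ∃ P : ℕ → Fin d → ℝ,
      ∀ t j, P t j = Real.sqrt (ν t j / (1 - β₂ ^ t) + ε) := ⟨_, fun _ _ => rfl⟩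
  have hP : ∀ t j, Real.sqrt ε ≤ P t j := fun t j => by
    rw [hPdef]
    apply Real.sqrt_le_sqrt
    have := div_nonneg (hνnonneg t j) (hpow₂' t)
    linarith
  have hPpos : ∀ t j, 0 < P t j := fun t j => hsε.trans_le (hP t j)
  have hmD : ∀ t, 1 ≤ t → ∀ j,
      m t j = -((1 - β₁ ^ t) / η) * P t j * (w (t + 1) - w t) j := by
    intro t ht j
    have h1 := hwrec t ht j
    rw [← hPdef] at h1
    have h2 : (w (t + 1) - w t) j = -(η * (m t j / (1 - β₁ ^ t)) / P t j) := by
      rw [PiLp.sub_apply, h1]; ring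
    rw [h2]
    have h3 : 1 - β₁ ^ t ≠ 0 := by linarith [hpow₁ t ht]
    have h4 := (hPpos t j).ne'
    field_simp
  have hPstep : ∀ t, 1 ≤ t → ∀ j, β₁ ^ 2 * P t j ≤
      ((1 - (cA * β₁) ^ (t + 1)) / (1 - (cA * β₁) ^ t) / cA) ^ 2 * P (t + 1) j := by
    intro t ht j
    have h1 := preconditioner_step hlam0 hcβ hε (hνnonneg t j) (y := ν (t + 1) j) (by
      rw [hν, ← hβ₂]
      have : 0 ≤ (1 - β₂) * gradL (w (t + 1)) j ^ 2 :=
        mul_nonneg (by linarith) (sq_nonneg _)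
      linarith) ht
    rw [← hβ₂, ← hPdef, ← hPdef] at h1
    rw [div_pow _ cA, div_mul_eq_mul_div, le_div_iff₀ (by positivity)]
    linarith
  obtain ⟨a, ha⟩ : ∃ a : ℕ → ℝ, ∀ t, a t = (1 - β₁ ^ t) / (1 - β₁) := ⟨_, fun _ => rfl⟩
  obtain ⟨A, hA⟩ : ∃ A : ℕ → ℝ, ∀ t, A t = ∑ j, P t j * (w (t + 1) - w t) j ^ 2 :=
    ⟨_, fun _ => rfl⟩
  obtain ⟨U, hU⟩ : ∃ U : ℕ → ℝ, ∀ t, U t =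
      (L (w (t + 1)) + a t / (2 * η) * A t) / (1 - (cA * β₁) ^ t) := ⟨_, fun _ => rfl⟩
  have hstep : ∀ t, 1 ≤ t → η * H_L / Real.sqrt ε ≤
      a (t + 1) - (1 - (cA * β₁) ^ (t + 1)) / (1 - (cA * β₁) ^ t) / cA * a t := by
    intro t ht
    set S := {y : ℝ | ∃ t : ℕ, 2 ≤ t ∧
        y = (1 - β₁ ^ t) / (1 - β₁) -
          ((1 - β₁ ^ (t - 1)) / (cA * (1 - β₁))) *
            ((1 - (cA * β₁) ^ t) / (1 - (cA * β₁) ^ (t - 1)))} with hS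
    have hbdd : BddBelow S := by
      by_contra h
      rw [Real.sInf_of_not_bddBelow h, mul_zero] at hηle
      linarith
    have h1 : η * H_L / Real.sqrt ε ≤ sInf S := by
      rw [div_le_iff₀ hsε]
      calc η * H_L ≤ Real.sqrt ε / H_L * sInf S * H_L :=
            mul_le_mul_of_nonneg_right hηle hH_Lpos.le
        _ = _ := by field_simp
    refine h1.trans (csInf_le hbdd ⟨t + 1, by omega, ?_⟩)
    rw [ha, ha, Nat.add_sub_cancel]
    field_simp
  set M := L (w 1) / (1 - cA * β₁) with hM
  have henergy := fun t (ht : 1 ≤ t) => adam_energy_decrease hH_Lpos.le hε hβ₁pos hβ₁lt hcA hcβ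
    hη hLpos (fun u v s => by
      rw [hLfun, hgfun]; exact hasDerivAt_average_loss_line hdiff u v s)
    hH_L hM ha hA hU hP hPstep hm0 hm hmD hstep ht
  have hlampow : ∀ t, 1 ≤ t → 1 - cA * β₁ ≤ 1 - (cA * β₁) ^ t := fun t ht => by
    have := pow_le_pow_of_le_one hlam0.le hcβ.le ht
    rw [pow_one] at this; linarith
  have hlampow' : ∀ t, 1 - (cA * β₁) ^ t ≤ 1 := fun t => by
    have : 0 < (cA * β₁) ^ t := by positivity
    linarith
  have ha1 : ∀ t, 1 ≤ t → 1 ≤ a t := fun t ht => by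
    rw [ha, le_div_iff₀ hb1]; linarith [hpow₁ t ht]
  have ha2 : ∀ t, a t ≤ 1 / (1 - β₁) := fun t => by
    rw [ha]
    apply div_le_div_of_nonneg_right _ hb1.le
    have : 0 < β₁ ^ t := by positivity
    linarith
  have hA0 : ∀ t, 0 ≤ A t := fun t =>
    hA t ▸ Finset.sum_nonneg fun j _ => mul_nonneg (hPpos t j).le (sq_nonneg _)
  have hUlower : ∀ t, 1 ≤ t → L (w (t + 1)) + 1 / (2 * η) * A t ≤ U t := by
    intro t ht
    have hp : 0 < 1 - (cA * β₁) ^ t := by linarith [hlampow t ht]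
    rw [hU, le_div_iff₀ hp]
    have h1 : 1 / (2 * η) * A t ≤ a t / (2 * η) * A t := by
      have := hA0 t
      have := ha1 t ht
      gcongr
    have h2 : 0 ≤ 1 / (2 * η) * A t := mul_nonneg (by positivity) (hA0 t)
    have h3 := hLpos (w (t + 1))
    nlinarith [hlampow' t]
  have hLle : ∀ t, 1 ≤ t → L (w t) ≤ M := by
    intro t ht
    rcases Nat.lt_or_ge 1 t with h | h
    · obtain ⟨s, rfl⟩ : ∃ s, t = s + 1 := ⟨t - 1, by omega⟩
      have hs : 1 ≤ s := by omega
      have h2 : 0 ≤ 1 / (2 * η) * A s := mul_nonneg (by positivity) (hA0 s)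
      linarith [hUlower s hs, (henergy s hs).1]
    · obtain rfl : t = 1 := by omega
      rw [hM, le_div_iff₀ (by linarith)]
      nlinarith [hLpos (w 1)]
  obtain ⟨s₀, hs₀⟩ := exists_le_of_loss_le hdiff hℓ'neg hℓ'bot (N * M)
  have hws : ∀ t, 1 ≤ t → ∀ i, s₀ ≤ ⟪w t, x i⟫ := fun t ht i =>
    hs₀ _ ((hℓL _ _).trans (mul_le_mul_of_nonneg_left (hLle t ht) hN0.le))
  obtain ⟨p, q, hp, hq, hpq⟩ := exp_tail_bounds_on_Ici hμp hμm hℓ'neg htailp htailm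
    (continuous_of_locally_lipschitz_above hloc) s₀
  have hpqℓ := fun s (hs : s₀ ≤ s) => loss_bounds_of_deriv_bounds hdiff hℓtop hpq hs
  have hupper : ∀ s, s₀ ≤ s → -ℓ' s ≤ q / p * ℓ s := fun s hs => by
    have h1 := (hpq s hs).2
    have h2 := (hpqℓ s hs).1
    calc -ℓ' s ≤ q / p * (p * Real.exp (-s)) := by
          rw [← mul_assoc, div_mul_cancel₀ _ hp.ne']; exact h1
      _ ≤ _ := by gcongr
  have hlower : ∀ s, s₀ ≤ s → p / q * ℓ s ≤ -ℓ' s := fun s hs => by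
    have h1 := (hpq s hs).1
    have h2 := (hpqℓ s hs).2
    calc p / q * ℓ s ≤ p / q * (q * Real.exp (-s)) := by gcongr
      _ ≤ _ := by rw [← mul_assoc, div_mul_cancel₀ _ hq.ne']; exact h1
  obtain ⟨X, hX0, hX⟩ : ∃ X : ℝ, 0 < X ∧ ∀ i, ‖x i‖ ≤ X :=
    ⟨∑ i, ‖x i‖ + 1, by positivity, fun i => by
      have := Finset.single_le_sum (f := fun i => ‖x i‖) (fun i _ => norm_nonneg _)
        (Finset.mem_univ i)
      linarith⟩
  have hgle : ∀ t, 1 ≤ t → ‖gradL (w t)‖ ≤ q / p * X * L (w t) := fun t ht => by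
    rw [hgraddef, hLdef]
    exact norm_average_smul_le hX fun i => by
      rw [abs_of_neg (hℓ'neg _)]; exact hupper _ (hws t ht i)
  have hgin : ∀ t, 1 ≤ t → p / q * L (w t) ≤ ⟪-gradL (w t), wmax⟫ := fun t ht => by
    rw [hgraddef, hLdef]
    exact le_inner_neg_average_smul hwmax (fun i => (hℓ'neg _).le)
      fun i => hlower _ (hws t ht i)
  have hwmax0 : 0 < ‖wmax‖ := by
    rw [norm_pos_iff]
    rintro rfl
    have := hwmax i₀
    rw [inner_zero_left] at this
    linarith
  have hLg : ∀ t, 1 ≤ t → L (w t) ≤ q / p * ‖wmax‖ * ‖gradL (w t)‖ := fun t ht => by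
    have h1 := (hgin t ht).trans (real_inner_le_norm _ _)
    rw [norm_neg] at h1
    calc L (w t) = q / p * (p / q * L (w t)) := by field_simp
      _ ≤ q / p * (‖gradL (w t)‖ * ‖wmax‖) := by gcongr
      _ = _ := by ring
  set K := q / p * X with hK
  have hK0 : 0 < K := by positivity
  have hLexp : ∀ t, 1 ≤ t →
      L (w t) * Real.exp (-(K * ‖w (t + 1) - w t‖)) ≤ L (w (t + 1)) := fun t ht => by
    have h := average_loss_mul_exp_neg_le (x := x) (ℓ := ℓ) (K := q / p) (by positivity) hX hℓpos
      (fun a b hab => mul_exp_neg_le_of_neg_deriv_le (b := b) (by positivity) hdiff hℓpos hℓ'neg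
        hupper hab) (v := w (t + 1)) (hws t ht)
    rw [hLdef, hLdef, hK, mul_assoc, Finset.sum_mul]
    exact h
  obtain ⟨Q, hQ0, hPQ⟩ : ∃ Q : ℝ, 0 < Q ∧ ∀ t, 1 ≤ t → ∀ j, P t j ≤ Q := by
    refine ⟨Real.sqrt ((K * M) ^ 2 + ε), Real.sqrt_pos.2 (by positivity), fun t ht j => ?_⟩
    rw [hPdef]
    apply Real.sqrt_le_sqrt
    have h1 := exponential_average_le (v := fun t => ν t j) (g := fun t => gradL (w t) j ^ 2)
      (B := (K * M) ^ 2) hβ₂0.le hβ₂1.le (by simp [hν0]) (fun t => hν t j) (fun t ht => by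
        rw [← sq_abs]
        refine pow_le_pow_left₀ (abs_nonneg _) ?_ 2
        have h2 : |gradL (w t) j| ≤ ‖gradL (w t)‖ := by
          simpa using PiLp.norm_apply_le (gradL (w t)) j
        refine h2.trans ((hgle t ht).trans ?_)
        exact mul_le_mul_of_nonneg_left (hLle t ht) hK0.le) t
    have h3 : ν t j / (1 - β₂ ^ t) ≤ (K * M) ^ 2 := by
      rw [div_le_iff₀ (hpow₂ t ht)]; exact h1
    linarith
  have hmvec : ∀ t, m (t + 1) = β₁ • m t + (1 - β₁) • gradL (w (t + 1)) := fun t => by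
    ext j; simp [hm]
  have hcoef : ∀ t, (1 - β₁ ^ t) / η ≤ 1 / η := fun t => by
    apply div_le_div_of_nonneg_right _ hη.le
    have : 0 < β₁ ^ t := by positivity
    linarith
  have hcoef0 : ∀ t, 1 ≤ t → 0 < (1 - β₁ ^ t) / η := fun t ht =>
    div_pos (by linarith [hpow₁ t ht]) hη
  have hmabs : ∀ t, 1 ≤ t → ∀ j,
      |m t j| = (1 - β₁ ^ t) / η * P t j * |(w (t + 1) - w t) j| := fun t ht j => by
    rw [hmD t ht j, abs_mul, neg_mul, abs_neg,
      abs_of_pos (mul_pos (hcoef0 t ht) (hPpos t j))]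
  have hmle : ∀ t, 1 ≤ t → ‖m t‖ ≤ 1 / η * Q * ‖w (t + 1) - w t‖ := fun t ht =>
    norm_le_mul_norm_of_coord (by positivity) fun j => by
      rw [hmabs t ht j]
      have := hPQ t ht j
      have := hcoef t
      have := (hPpos t j).le
      gcongr
  set R := η / ((1 - β₁) * Real.sqrt ε) with hR
  have hR0 : 0 < R := by positivity
  have hDle : ∀ t, 1 ≤ t → ‖w (t + 1) - w t‖ ≤ R * ‖m t‖ := fun t ht =>
    norm_le_mul_norm_of_coord hR0.le fun j => by
      rw [hmabs t ht j]
      have h1 : (1 - β₁) / η * Real.sqrt ε ≤ (1 - β₁ ^ t) / η * P t j := by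
        have := hP t j
        have := hpow₁ t ht
        have := hcoef0 t ht
        gcongr
      have h2 : R * ((1 - β₁) / η * Real.sqrt ε) = 1 := by
        rw [hR]; field_simp
      calc |(w (t + 1) - w t) j|
          = R * ((1 - β₁) / η * Real.sqrt ε) * |(w (t + 1) - w t) j| := by rw [h2, one_mul]
        _ ≤ R * ((1 - β₁ ^ t) / η * P t j) * |(w (t + 1) - w t) j| := by gcongr
        _ = _ := by ring
  have hDA : ∀ t, Real.sqrt ε * ‖w (t + 1) - w t‖ ^ 2 ≤ A t := fun t => by
    rw [EuclideanSpace.real_norm_sq_eq, Finset.mul_sum, hA]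
    exact Finset.sum_le_sum fun j _ => mul_le_mul_of_nonneg_right (hP t j) (sq_nonneg _)
  have hmA : ∀ t, 1 ≤ t → ‖m t‖ ^ 2 ≤ (1 / η * Q) ^ 2 / Real.sqrt ε * A t := fun t ht => by
    calc ‖m t‖ ^ 2 ≤ (1 / η * Q * ‖w (t + 1) - w t‖) ^ 2 :=
          pow_le_pow_left₀ (norm_nonneg _) (hmle t ht) 2
      _ = (1 / η * Q) ^ 2 / Real.sqrt ε * (Real.sqrt ε * ‖w (t + 1) - w t‖ ^ 2) := by
          field_simp
      _ ≤ _ := mul_le_mul_of_nonneg_left (hDA t) (by positivity)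
  set V := (1 / η * Q) ^ 2 / Real.sqrt ε with hV
  have hLsq : ∀ t, 1 ≤ t → L (w (t + 1)) ^ 2 ≤
      (q / p * ‖wmax‖) ^ 2 * (2 * V / (1 - β₁) ^ 2) * (A t + A (t + 1)) := by
    intro t ht
    have h1 : (1 - β₁) * ‖gradL (w (t + 1))‖ ≤ ‖m (t + 1)‖ + ‖m t‖ := by
      have h2 : (1 - β₁) • gradL (w (t + 1)) = m (t + 1) - β₁ • m t := by rw [hmvec]; abel
      have h3 := norm_sub_le (m (t + 1)) (β₁ • m t)
      rw [← h2, norm_smul, norm_smul, Real.norm_of_nonneg hb1.le,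
        Real.norm_of_nonneg hβ₁pos.le] at h3
      nlinarith [norm_nonneg (m t)]
    have h4 : ((1 - β₁) * ‖gradL (w (t + 1))‖) ^ 2 ≤ 2 * V * (A t + A (t + 1)) := by
      have h5 := pow_le_pow_left₀ (by positivity) h1 2
      have h6 := hmA t ht
      have h7 := hmA (t + 1) (by omega)
      nlinarith [sq_nonneg (‖m (t + 1)‖ - ‖m t‖)]
    calc L (w (t + 1)) ^ 2 ≤ (q / p * ‖wmax‖ * ‖gradL (w (t + 1))‖) ^ 2 :=
          pow_le_pow_left₀ (hLpos _).le (hLg (t + 1) (by omega)) 2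
      _ = (q / p * ‖wmax‖) ^ 2 / (1 - β₁) ^ 2 * ((1 - β₁) * ‖gradL (w (t + 1))‖) ^ 2 := by
          field_simp
      _ ≤ (q / p * ‖wmax‖) ^ 2 / (1 - β₁) ^ 2 * (2 * V * (A t + A (t + 1))) := by gcongr
      _ = _ := by ring
  have hUpper : ∀ t, 1 ≤ t → U t ≤
      (1 + 1 / (1 - β₁) / (2 * η)) / (1 - cA * β₁) * (L (w (t + 1)) + A t) := by
    intro t ht
    have h0 := hA0 t
    have h1 := hLpos (w (t + 1))
    have h2 : L (w (t + 1)) + a t / (2 * η) * A t ≤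
        (1 + 1 / (1 - β₁) / (2 * η)) * (L (w (t + 1)) + A t) := by
      have h3 : a t / (2 * η) * A t ≤ 1 / (1 - β₁) / (2 * η) * A t := by
        have := ha2 t
        gcongr
      have h4 : 0 ≤ 1 / (1 - β₁) / (2 * η) * L (w (t + 1)) := by positivity
      linarith
    have h5 : 0 < 1 - cA * β₁ := by linarith
    rw [hU, div_mul_eq_mul_div (1 + 1 / (1 - β₁) / (2 * η))]
    exact div_le_div₀ (by positivity) h2 h5 (hlampow t ht)
  have hcinv : 1 / cA < 1 := by rw [div_lt_one (by linarith)]; exact hcA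
  have hAU : ∀ t, 1 ≤ t → 1 / (2 * η) * A t ≤ U t := fun t ht => by
    linarith [hUlower t ht, hLpos (w (t + 1))]
  obtain ⟨C, hC0, hC⟩ := energy_le_div (U := U) (A := A) (l := fun t => L (w t))
    (κ := (1 - 1 / cA) / (2 * η)) (k := 1 / (2 * η)) (M := M)
    (C₁ := (q / p * ‖wmax‖) ^ 2 * (2 * V / (1 - β₁) ^ 2))
    (C₂ := (1 + 1 / (1 - β₁) / (2 * η)) / (1 - cA * β₁))
    (div_pos (by linarith) (by positivity)) (by positivity) (by positivity)
    (div_pos (by positivity) (by linarith)) hA0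
    (fun t ht => by
      have : 0 ≤ 1 / (2 * η) * A t := mul_nonneg (by positivity) (hA0 t)
      linarith [hUlower t ht, hLpos (w (t + 1))])
    (fun t ht => (henergy t ht).1) (fun t ht => (henergy t ht).2) hLsq hUpper hAU
  have hLC : ∀ t : ℕ, 5 ≤ t → L (w t) ≤ 2 * C / t := by
    intro t ht
    obtain ⟨s, rfl⟩ : ∃ s, t = s + 1 := ⟨t - 1, by omega⟩
    have hs : (4 : ℝ) ≤ s := by exact_mod_cast (by omega : 4 ≤ s)
    have h1 : 0 ≤ 1 / (2 * η) * A s := mul_nonneg (by positivity) (hA0 s)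
    have h2 : C / (s : ℝ) ≤ 2 * C / ((s + 1 : ℕ) : ℝ) := by
      push_cast
      rw [div_le_div_iff₀ (by positivity) (by positivity)]
      nlinarith
    linarith [hUlower s (by omega), hC s (by omega)]
  have hD0 : Tendsto (fun t => ‖w (t + 1) - w t‖) atTop (𝓝 0) := by
    have h1 : Tendsto (fun t : ℕ => 2 * η / Real.sqrt ε * (C / t)) atTop (𝓝 0) := by
      simpa using (tendsto_const_div_atTop_nhds_zero_nat C).const_mul (2 * η / Real.sqrt ε)
    have h2 : Tendsto (fun t => ‖w (t + 1) - w t‖ ^ 2) atTop (𝓝 0) := by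
      refine squeeze_zero' (Eventually.of_forall fun t => sq_nonneg _) ?_ h1
      filter_upwards [eventually_ge_atTop 4] with t ht
      have h3 := (hAU t (by omega)).trans (hC t ht)
      calc ‖w (t + 1) - w t‖ ^ 2
          = 1 / Real.sqrt ε * (Real.sqrt ε * ‖w (t + 1) - w t‖ ^ 2) := by field_simp
        _ ≤ 1 / Real.sqrt ε * A t := mul_le_mul_of_nonneg_left (hDA t) (by positivity)
        _ = 2 * η / Real.sqrt ε * (1 / (2 * η) * A t) := by field_simp
        _ ≤ _ := by gcongr
    have h4 := (Real.continuous_sqrt.tendsto 0).comp h2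
    simpa [Function.comp_def, Real.sqrt_sq (norm_nonneg _)] using h4
  obtain ⟨K', hK'0, T₁, hT₁⟩ := exists_momentum_norm_le (l := fun t => L (w t)) hβ₁pos hβ₁lt
    hK0.le hmvec (fun t => hLpos _) hgle hD0 hLexp
  have hDL : ∀ t, max T₁ 5 ≤ t → ‖w (t + 1) - w t‖ ≤ R * K' * L (w t) := fun t ht => by
    have h1 := hDle t (by omega)
    have h2 := hT₁ t (by omega)
    calc _ ≤ R * ‖m t‖ := h1
      _ ≤ R * (K' * L (w t)) := by gcongr
      _ = _ := by ring
  obtain ⟨c₁, hc₁, hLlow⟩ := div_le_of_exp_decrease (a := fun t => L (w t))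
    (K := K * (R * K')) (M := M) (T := max T₁ 5) (by positivity) (fun t _ => hLpos _)
    (fun t ht => hLle t (by omega)) (fun t ht => by
      refine le_trans (mul_le_mul_of_nonneg_left (Real.exp_le_exp.2 ?_) (hLpos _).le)
        (hLexp t (by omega))
      have := mul_le_mul_of_nonneg_left (hDL t ht) hK0.le
      linarith)
  have hDupper : ∀ t : ℕ, max T₁ 5 ≤ t → ‖w (t + 1) - w t‖ ≤ R * K' * (2 * C) / t := by
    intro t ht
    calc _ ≤ R * K' * L (w t) := hDL t ht
      _ ≤ R * K' * (2 * C / t) := by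
        have := hLC t (by omega)
        gcongr
      _ = _ := by ring
  obtain ⟨c₄, hc₄, hwlog⟩ := exists_norm_le_log (by positivity) (by omega) hDupper
  obtain ⟨c₃, hc₃, T₂, hT₂⟩ := exists_log_le_norm (ℓ := ℓ) (B := N * (2 * C)) (T := 5) hp
    (by positivity) hX0 (hX i₀) (fun t ht => hws t (by omega) i₀)
    (fun s hs => (hpqℓ s hs).1) (fun t ht => by
      refine (hℓL _ _).trans ?_
      rw [mul_div_assoc]
      exact mul_le_mul_of_nonneg_left (hLC t ht) hN0.le)
  have hmin0 : ∀ t, 0 ≤ ⟪-m t, wmax⟫ ∧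
      (1 - β₁) * (p / q * L (w (t + 1))) ≤ ⟪-m (t + 1), wmax⟫ := by
    have hrec : ∀ t, 0 ≤ ⟪-m t, wmax⟫ →
        (1 - β₁) * (p / q * L (w (t + 1))) ≤ ⟪-m (t + 1), wmax⟫ := by
      intro t h0
      have h1 : -m (t + 1) = β₁ • (-m t) + (1 - β₁) • (-gradL (w (t + 1))) := by
        rw [hmvec, smul_neg, smul_neg, neg_add]
      rw [h1, inner_add_left, real_inner_smul_left, real_inner_smul_left]
      have h2 := mul_le_mul_of_nonneg_left (hgin (t + 1) (by omega)) hb1.le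
      have h3 := mul_nonneg hβ₁pos.le h0
      linarith
    intro t
    induction t with
    | zero => exact ⟨by simp [hm0], hrec 0 (by simp [hm0])⟩
    | succ t ih =>
      have h0 : 0 ≤ ⟪-m (t + 1), wmax⟫ :=
        le_trans (mul_nonneg hb1.le (mul_nonneg (by positivity) (hLpos _).le)) ih.2
      exact ⟨h0, hrec _ h0⟩
  have hDlower : ∀ t, 1 ≤ t →
      (1 - β₁) * (p / q) / (1 / η * Q * ‖wmax‖) * L (w t) ≤ ‖w (t + 1) - w t‖ := by
    intro t ht
    obtain ⟨s, rfl⟩ : ∃ s, t = s + 1 := ⟨t - 1, by omega⟩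
    have h1 := (hmin0 s).2.trans (real_inner_le_norm _ _)
    rw [norm_neg] at h1
    have h2 := mul_le_mul_of_nonneg_right (hmle (s + 1) ht) hwmax0.le
    rw [div_mul_eq_mul_div, div_le_iff₀ (by positivity)]
    linarith
  refine ⟨c₁, 2 * C, c₃, c₄, (1 - β₁) * (p / q) / (1 / η * Q * ‖wmax‖) * c₁, R * K' * (2 * C),
    hc₁, by positivity, hc₃, hc₄, by positivity, by positivity, max (max T₁ 5) T₂,
    fun t ht => ⟨⟨hLlow t (by omega) (by omega), hLC t (by omega)⟩,
      ⟨hT₂ t (by omega), hwlog t (by omega)⟩, ?_, hDupper t (by omega)⟩⟩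
  refine le_trans ?_ (hDlower t (by omega))
  rw [mul_div_assoc]
  exact mul_le_mul_of_nonneg_left (hLlow t (by omega) (by omega)) (by positivity)
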